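/- Let 0<q<1 (with q^{1/2} the positive square root), let n∈ℕ, let a,b be nonzero complex numbers, and let x∈ℂ. Assume that (ab;q²)_j, (qa²;q²)_j and (qab;q²)_j are nonzero for 0≤j≤n, and that (ab;q)_j, (q^{1/2}a;q)_j and (−q^{1/2}a;q)_j are nonzero for 0≤j≤n. Then Singh's quadratic transformation formula for terminating balanced ₄φ₃ series holds: Σ_{j=0}^{n} (q^{−2n}, a q^x, a q^{−x}, q^{2n}a²b²; q²)_j · q^{2j} / (q², ab, qa², qab; q²)_j = Σ_{j=0}^{n} (q^{−n}, a q^x, a q^{−x}, −q^{n}ab; q)_j · q^{j} / (q, ab, q^{1/2}a, −q^{1/2}a; q)_j. -/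

import Mathlib

noncomputable section

/-- `qc q x = q^x := exp(x·log q)` for a real base `q` and complex exponent `x`. -/
def qc (q : ℝ) (x : ℂ) : ℂ := Complex.exp (x * Complex.log (q : ℂ))

/-- Finite q-shifted factorial `(a;p)_n`. -/
def qPoch (a p : ℂ) (n : ℕ) : ℂ := ∏ i ∈ Finset.range n, (1 - a * p ^ i)

/-- Infinite q-shifted factorial `(a;p)_∞`. -/
def qPochInf (a p : ℂ) : ℂ := ∏' i : ℕ, (1 - a * p ^ i)

/-- Very-well-poised basic hypergeometric series `₈W₇(a₀;a₁,…,a₅;p,u)`. -/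
def W8 (a0 a1 a2 a3 a4 a5 p u : ℂ) : ℂ :=
  ∑' r : ℕ, ((1 - a0 * p ^ (2 * r)) / (1 - a0)) * u ^ r *
    ((qPoch a0 p r * qPoch a1 p r * qPoch a2 p r * qPoch a3 p r * qPoch a4 p r *
        qPoch a5 p r) /
      (qPoch (p * a0 / a0) p r * qPoch (p * a0 / a1) p r * qPoch (p * a0 / a2) p r *
        qPoch (p * a0 / a3) p r * qPoch (p * a0 / a4) p r * qPoch (p * a0 / a5) p r))

/-- All the "denominator" factors of the `₈W₇` series are nonzero. -/
def W8Denom (a0 a1 a2 a3 a4 a5 p : ℂ) : Prop :=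
  1 - a0 ≠ 0 ∧ ∀ r : ℕ,
    qPoch (p * a0 / a0) p r ≠ 0 ∧ qPoch (p * a0 / a1) p r ≠ 0 ∧
    qPoch (p * a0 / a2) p r ≠ 0 ∧ qPoch (p * a0 / a3) p r ≠ 0 ∧
    qPoch (p * a0 / a4) p r ≠ 0 ∧ qPoch (p * a0 / a5) p r ≠ 0

/-- Basic hypergeometric series `₄φ₃(a₁,a₂,a₃,a₄;b₁,b₂,b₃;p,u)`. -/
def phi43 (a1 a2 a3 a4 b1 b2 b3 p u : ℂ) : ℂ :=
  ∑' j : ℕ, (qPoch a1 p j * qPoch a2 p j * qPoch a3 p j * qPoch a4 p j) * u ^ j /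
    (qPoch p p j * qPoch b1 p j * qPoch b2 p j * qPoch b3 p j)

/-- Modified Jacobi theta function `θ(u;p)`. -/
def theta (u p : ℂ) : ℂ := qPochInf u p * qPochInf (p / u) p

/-- Askey–Wilson parameter `a_s = q^{κ+λ}`. -/
def aP (q : ℝ) (k lm : ℝ) : ℂ := qc q (k + lm)

/-- Askey–Wilson parameter `b_s = -q^{κ-λ}`. -/
def bP (q : ℝ) (k lm : ℝ) : ℂ := -qc q (k - lm)

/-- Askey–Wilson parameter `c_s = q^{s/2+υ+ς}`. -/
def cP (q : ℝ) (s up sg : ℝ) : ℂ := qc q (s / 2 + up + sg)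

/-- Askey–Wilson parameter `d_s = -q^{s/2+υ-ς}`. -/
def dP (q : ℝ) (s up sg : ℝ) : ℂ := -qc q (s / 2 + up - sg)

/-- The weight `W(x,z) = q^{(κ+λ+x)(κ+υ+z)/s}`. -/
def Wgt (q s k lm up : ℝ) (x z : ℂ) : ℂ := qc q ((k + lm + x) * (k + up + z) / s)

/-- The singular term `St(x)`; dual version is obtained by swapping `lm` and `up`. -/
def St (q s k lm up sg : ℝ) (x : ℂ) : ℂ :=
  qPochInf (qc q (s + x) / aP q k lm) (qc q s) * qPochInf (qc q (s + x) / bP q k lm) (qc q s) *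
  qPochInf (qc q (s + x) / cP q s up sg) (qc q s) *
  qPochInf (qc q (s + x) / dP q s up sg) (qc q s)

/-- The series part `Ψ(x,z)` of the asymptotically free eigenfunction. -/
def Psi (q s k lm up sg : ℝ) (x z : ℂ) : ℂ :=
  (qPochInf (qc q (s + x + z) * aP q k lm / aP q k up) (qc q s) *
   qPochInf (qc q (s + x + z) * bP q k lm / aP q k up) (qc q s) *
   qPochInf (qc q (s + x + z) * cP q s up sg / aP q k up) (qc q s) *
   qPochInf (qc q (s + x + z) * aP q k up / dP q s up sg) (qc q s) *
   qPochInf (qc q (s + 2 * z)) (qc q s) *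
   qPochInf (dP q s up sg * qc q x) (qc q s) /
   qPochInf (qc q (2 * s + x + 2 * z) / dP q s up sg) (qc q s)) *
  W8 (qc q (s + x + 2 * z) / dP q s up sg) (qc q (s + z) / aP q k up)
     (qc q (s + z) / dP q s lm sg) (bP q k up * qc q z) (cP q s lm sg * qc q z)
     (qc q (s + x) / dP q s up sg) (qc q s) (dP q s up sg * qc q x)

/-- The asymptotically free eigenfunction `Φ(x,z;κ,λ,υ,ς;q,s)`. -/
def Phi (q s k lm up sg : ℝ) (x z : ℂ) : ℂ :=
  Wgt q s k lm up x z * Psi q s k lm up sg x z /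
    (St q s k lm up sg x * St q s k up lm sg z)

/-- The Askey–Wilson function `E(x,z;κ,λ,υ,ς;q,s)`. -/
def AWE (q s k lm up sg : ℝ) (x z : ℂ) : ℂ :=
  (qPochInf (aP q k up * qc q (s + z - x) / dP q s up sg) (qc q s) *
   qPochInf (aP q k up * qc q (s + z + x) / dP q s up sg) (qc q s) *
   qPochInf (aP q k lm * bP q k lm) (qc q s) *
   qPochInf (aP q k lm * cP q s up sg) (qc q s) *
   qPochInf (qc q s * aP q k lm / dP q s up sg) (qc q s)) /
  (qPochInf (qc q (s + x) / dP q s up sg) (qc q s) *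
   qPochInf (qc q (s - x) / dP q s up sg) (qc q s) *
   qPochInf (qc q (s + z) / dP q s lm sg) (qc q s) *
   qPochInf (aP q k up * bP q k up * cP q s lm sg * qc q z) (qc q s)) *
  W8 (aP q k up * bP q k up * cP q s lm sg * qc q (-s + z))
     (aP q k lm * qc q x) (aP q k lm * qc q (-x)) (aP q k up * qc q z)
     (bP q k up * qc q z) (cP q s lm sg * qc q z) (qc q s) (qc q (s - z) / dP q s lm sg)

/-- The normalized `c`-function; the dual version swaps `lm` and `up`. -/
def cF (q s k lm up sg : ℝ) (x z : ℂ) : ℂ :=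
  (theta (aP q k up * qc q (-z)) (qc q s) * theta (bP q k up * qc q (-z)) (qc q s) *
   theta (cP q s lm sg * qc q (-z)) (qc q s) *
   theta (dP q s up sg * qc q (x - z) / aP q k up) (qc q s)) /
  (Wgt q s k lm up x z *
    (theta (qc q (-(2 * z))) (qc q s) * theta (dP q s up sg * qc q x) (qc q s)))

/-- The coefficient `A(x)` of the Askey–Wilson difference operator. -/
def AOp (q s k lm up sg : ℝ) (x : ℂ) : ℂ :=
  ((1 - aP q k lm * qc q x) * (1 - bP q k lm * qc q x) * (1 - cP q s up sg * qc q x) *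
    (1 - dP q s up sg * qc q x)) /
  (aP q k up * (1 - qc q (2 * x)) * (1 - qc q (s + 2 * x)))

section

open Finset

theorem qPoch_zero (a p : ℂ) : qPoch a p 0 = 1 := by simp [qPoch]

theorem qPoch_succ (a p : ℂ) (k : ℕ) :
    qPoch a p (k + 1) = qPoch a p k * (1 - a * p ^ k) := by
  simp [qPoch, prod_range_succ]

theorem qPoch_add (a p : ℂ) (m l : ℕ) :
    qPoch a p (m + l) = qPoch a p m * qPoch (a * p ^ m) p l := by
  simp [qPoch, prod_range_add, pow_add, mul_assoc]

theorem qPoch_succ_left (a p : ℂ) (k : ℕ) :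
    qPoch a p (k + 1) = (1 - a) * qPoch (a * p) p k := by
  rw [add_comm, qPoch_add]; simp [qPoch]

theorem qPoch_sq (a p : ℂ) (k : ℕ) :
    qPoch (a ^ 2) (p ^ 2) k = qPoch a p k * qPoch (-a) p k := by
  rw [qPoch, qPoch, qPoch, ← prod_mul_distrib]
  refine prod_congr rfl fun i _ => ?_
  ring

theorem qPoch_two_mul (c p : ℂ) (k : ℕ) :
    qPoch c p (2 * k) = qPoch c (p ^ 2) k * qPoch (p * c) (p ^ 2) k := by
  induction k with
  | zero => simp [qPoch]
  | succ k ih =>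
    rw [show 2 * (k + 1) = 2 * k + 1 + 1 by ring, qPoch_succ, qPoch_succ, ih, qPoch_succ,
      qPoch_succ]
    ring

/-- The summand of the `q`-Pfaff–Saalschütz sum, cleared of its parameter denominators. -/
def saalTerm (q α β w : ℂ) (M m : ℕ) : ℂ :=
  qPoch q q M / (qPoch q q m * qPoch q q (M - m)) * w ^ m * qPoch α q m * qPoch β q m *
    qPoch (w * α * β * q ^ m) q (M - m) * qPoch w q (M - m)

/-- Partial sums of consecutive `q`-Pfaff–Saalschütz sums differ by a closed form. -/
theorem sum_saalTerm_succ (q α β w : ℂ) (hq : ∀ k, qPoch q q k ≠ 0) (M p : ℕ) (hp : p ≤ M) :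
    ∑ m ∈ range (p + 1), saalTerm q α β w (M + 1) m =
      (1 - w * α * q ^ M) * (1 - w * β * q ^ M) * ∑ m ∈ range (p + 1), saalTerm q α β w M m -
        q ^ (M - p) * w * (1 - α * q ^ p) * (1 - β * q ^ p) * saalTerm q α β w M p := by
  induction p with
  | zero =>
    have h := hq M
    have h' := hq (M + 1)
    simp only [zero_add, sum_range_one, saalTerm, Nat.sub_zero, qPoch_zero, pow_zero, one_mul,
      mul_one, div_self h, div_self h']
    simp only [qPoch_succ]
    ring
  | succ p ih =>
    obtain ⟨l, rfl⟩ := Nat.exists_eq_add_of_le hp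
    rw [sum_range_succ, ih (by omega), sum_range_succ _ (p + 1)]
    have e1 : p + 1 + l + 1 - (p + 1) = l + 1 := by omega
    have e2 : p + 1 + l - p = l + 1 := by omega
    have e3 : p + 1 + l - (p + 1) = l := by omega
    generalize ∑ m ∈ range (p + 1), saalTerm q α β w (p + 1 + l) m = S
    simp only [saalTerm, e1, e2, e3]
    have a1 := hq (p + 1)
    have a2 := hq (l + 1)
    have a3 := hq p
    have a4 := hq l
    have a5 := hq (p + 1 + l)
    rw [qPoch_succ] at a1 a2
    have b1 := right_ne_zero_of_mul a1
    have b2 := right_ne_zero_of_mul a2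
    rw [qPoch_succ_left (w * α * β * q ^ p), qPoch_succ q q (p + 1 + l), qPoch_succ q q p,
      qPoch_succ q q l, qPoch_succ (w * α * β * q ^ (p + 1)) q l, qPoch_succ α, qPoch_succ β, qPoch_succ w q l,
      show w * α * β * q ^ p * q = w * α * β * q ^ (p + 1) by ring]
    generalize qPoch (w * α * β * q ^ (p + 1)) q l = X at *
    simp only [pow_add, pow_one] at *
    generalize q ^ p = y at *
    generalize q ^ l = z at *
    rw [mul_comm q y] at *
    field_simp
    ring

/-- The `q`-Pfaff–Saalschütz sum in polynomial form. -/
theorem sum_saalTerm (q α β w : ℂ) (hq : ∀ k, qPoch q q k ≠ 0) (M : ℕ) :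
    ∑ m ∈ range (M + 1), saalTerm q α β w M m = qPoch (w * α) q M * qPoch (w * β) q M := by
  induction M with
  | zero => simp [saalTerm, qPoch]
  | succ M ih =>
    rw [sum_range_succ, sum_saalTerm_succ q α β w hq M M le_rfl, ih]
    have a1 := hq (M + 1)
    have a3 := hq M
    simp only [saalTerm, Nat.sub_self, qPoch_zero, mul_one, pow_zero, div_self a1, div_self a3]
    simp only [qPoch_succ]
    ring

/-- Connection coefficients expanding `(u,v;q)_k / (quv;q²)_k` in `(u,v;q²)_j / (quv;q²)_j`. -/
def connCoeff (q : ℂ) (k j : ℕ) : ℂ :=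
  if j ≤ k ∧ k ≤ 2 * j then
    (-1) ^ (k - j) * q ^ (k - j).choose 2 * qPoch q q k /
      (q ^ (j.choose 2 + j * (k - j)) * qPoch q q (2 * j - k) * qPoch (q ^ 2) (q ^ 2) (k - j))
  else 0

theorem connCoeff_add (q : ℂ) (m l : ℕ) :
    connCoeff q (2 * m + l) (m + l) =
      (-1) ^ m * q ^ m.choose 2 * qPoch q q (2 * m + l) /
      (q ^ ((m + l).choose 2 + (m + l) * m) * qPoch q q l * qPoch (q ^ 2) (q ^ 2) m) := by
  rw [connCoeff, if_pos (by omega), show 2 * m + l - (m + l) = m by omega,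
    show 2 * (m + l) - (2 * m + l) = l by omega]

theorem connCoeff_eq_zero {q : ℂ} {k j : ℕ} (h : k < j ∨ 2 * j < k) : connCoeff q k j = 0 := by
  rw [connCoeff, if_neg (by omega)]

theorem choose_two_succ (m : ℕ) : (m + 1).choose 2 = m + m.choose 2 := by
  rw [Nat.choose_succ_succ' m 1, Nat.choose_one_right]

theorem connCoeff_rec (q : ℂ) (hq0 : q ≠ 0) (hq : ∀ k, qPoch q q k ≠ 0)
    (hq2 : ∀ k, qPoch (q ^ 2) (q ^ 2) k ≠ 0) (k p : ℕ) (hp : p + 1 ≤ k) :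
    connCoeff q (k + 1) (p + 1) = (1 - q ^ k / q ^ (2 * (p + 1))) * connCoeff q k (p + 1) +
      q ^ k / q ^ (2 * p) * connCoeff q k p ∧
    q ^ (2 * k) * connCoeff q k (p + 1) + q ^ (2 * k + 1) * connCoeff q (k + 1) (p + 1) =
      q ^ (k + 2 * (p + 1)) * connCoeff q k (p + 1) + q ^ (k + 1) * connCoeff q k p := by
  rcases lt_trichotomy k (2 * (p + 1)) with h | h | h
  · obtain ⟨m, rfl⟩ := Nat.exists_eq_add_of_le hp
    obtain ⟨l, hl⟩ : ∃ l, p = m + l := ⟨p - m, by omega⟩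
    subst hl
    have h1 := connCoeff_add q m (l + 1)
    have h2 := connCoeff_add q (m + 1) l
    rw [show 2 * m + (l + 1) = m + l + 1 + m by ring,
      show m + (l + 1) = m + l + 1 by ring] at h1
    rw [show 2 * (m + 1) + l = m + l + 1 + m + 1 by ring,
      show m + 1 + l = m + l + 1 by ring] at h2
    have a1 := hq (l + 1)
    have a2 := hq2 (m + 1)
    have a3 := hq l
    have a4 := hq2 m
    rw [qPoch_succ] at a1 a2
    have b1 := right_ne_zero_of_mul a1
    have b2 := right_ne_zero_of_mul a2
    rw [h1, h2]
    rcases l with _ | l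
    · rw [connCoeff_eq_zero (k := m + 0 + 1 + m) (j := m + 0) (by omega)]
      simp only [qPoch_succ q q (m + 0 + 1 + m), qPoch_succ q q 0, qPoch_succ _ _ m,
        choose_two_succ, qPoch_zero, pow_zero, mul_one, one_mul] at *
      constructor
      · field_simp
        ring
      · field_simp
        ring
    · have h3 := connCoeff_add q (m + 1) l
      rw [show 2 * (m + 1) + l = m + (l + 1) + 1 + m by ring,
        show m + 1 + l = m + (l + 1) by ring] at h3
      have a5 := hq l
      rw [qPoch_succ] at a3
      have b3 := right_ne_zero_of_mul a3
      rw [h3]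
      simp only [qPoch_succ q q (m + (l + 1) + 1 + m), qPoch_succ q q (l + 1), qPoch_succ q q l,
        qPoch_succ _ _ m, choose_two_succ] at *
      constructor
      · field_simp
        ring
      · field_simp
        ring
  · subst h
    rw [connCoeff_eq_zero (k := 2 * (p + 1) + 1) (by omega),
      connCoeff_eq_zero (k := 2 * (p + 1)) (j := p) (by omega), div_self (pow_ne_zero _ hq0)]
    constructor <;> ring
  · rw [connCoeff_eq_zero (by omega), connCoeff_eq_zero (by omega), connCoeff_eq_zero (by omega)]
    simp

/-- The ratio `(u,v;p)_j / (quv;q²)_j`. -/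
def pairRatio (q u v p : ℂ) (j : ℕ) : ℂ :=
  qPoch u p j * qPoch v p j / qPoch (q * (u * v)) (q ^ 2) j

theorem pairRatio_succ (q u v p : ℂ) (j : ℕ) (h : qPoch (q * (u * v)) (q ^ 2) (j + 1) ≠ 0) :
    pairRatio q u v p (j + 1) * (1 - q ^ (2 * j + 1) * (u * v)) =
      pairRatio q u v p j * ((1 - u * p ^ j) * (1 - v * p ^ j)) := by
  rw [qPoch_succ] at h
  have h1 := left_ne_zero_of_mul h
  have h2 := right_ne_zero_of_mul h
  have e : 1 - q ^ (2 * j + 1) * (u * v) = 1 - q * (u * v) * (q ^ 2) ^ j := by ring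
  rw [e]
  simp only [pairRatio, qPoch_succ]
  generalize qPoch (q * (u * v)) (q ^ 2) j = P at *
  generalize q * (u * v) * (q ^ 2) ^ j = Z at *
  field_simp

theorem sum_connCoeff_succ (q u v : ℂ) (hq0 : q ≠ 0) (hq : ∀ k, qPoch q q k ≠ 0)
    (hq2 : ∀ k, qPoch (q ^ 2) (q ^ 2) k ≠ 0) (k p : ℕ)
    (huv : ∀ j ≤ k, qPoch (q * (u * v)) (q ^ 2) j ≠ 0) (hp : p ≤ k) :
    (1 - q ^ (2 * k + 1) * (u * v)) *
        ∑ j ∈ range (p + 1), connCoeff q (k + 1) j * pairRatio q u v (q ^ 2) j =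
      (1 - u * q ^ k) * (1 - v * q ^ k) *
        ∑ j ∈ range (p + 1), connCoeff q k j * pairRatio q u v (q ^ 2) j -
      q ^ k / q ^ (2 * p) * connCoeff q k p *
        (pairRatio q u v (q ^ 2) p * ((1 - u * (q ^ 2) ^ p) * (1 - v * (q ^ 2) ^ p))) := by
  induction p with
  | zero =>
    simp only [zero_add, sum_range_one, connCoeff_eq_zero (k := k + 1) (j := 0) (by omega)]
    rcases k with _ | k
    · simp
      ring
    · simp [connCoeff_eq_zero (k := k + 1) (j := 0)]
  | succ p ih =>
    rw [sum_range_succ, mul_add, ih (by omega), sum_range_succ _ (p + 1),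
      ← pairRatio_succ q u v _ p (huv _ hp)]
    obtain ⟨h1, h2⟩ := connCoeff_rec q hq0 hq hq2 k p hp
    have e : q ^ k / q ^ (2 * (p + 1)) * (q ^ 2) ^ (p + 1) = q ^ k := by
      rw [← pow_mul]
      exact div_mul_cancel₀ _ (pow_ne_zero _ hq0)
    have e' : q ^ k / q ^ (2 * p) * q ^ (2 * p) = q ^ k :=
      div_mul_cancel₀ _ (pow_ne_zero _ hq0)
    generalize q ^ k / q ^ (2 * (p + 1)) = s at *
    generalize q ^ k / q ^ (2 * p) = sprev at *
    generalize connCoeff q k (p + 1) = D at *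
    generalize connCoeff q (k + 1) (p + 1) = Dnext at *
    generalize connCoeff q k p = Dprev at *
    generalize pairRatio q u v (q ^ 2) (p + 1) = L at *
    linear_combination L * h1 - L * u * v * h2 + L * Dprev * u * v * q * e' +
      (L * D * u * v * (q ^ 2) ^ (p + 1) - L * D * (u + v)) * e

theorem pairRatio_eq_sum (q u v : ℂ) (hq0 : q ≠ 0) (hq : ∀ k, qPoch q q k ≠ 0)
    (hq2 : ∀ k, qPoch (q ^ 2) (q ^ 2) k ≠ 0) (k : ℕ)
    (huv : ∀ j ≤ k, qPoch (q * (u * v)) (q ^ 2) j ≠ 0) :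
    pairRatio q u v q k =
      ∑ j ∈ range (k + 1), connCoeff q k j * pairRatio q u v (q ^ 2) j := by
  induction k with
  | zero => simp [connCoeff, pairRatio, qPoch]
  | succ k ih =>
    have hne : 1 - q ^ (2 * k + 1) * (u * v) ≠ 0 := by
      have := huv (k + 1) le_rfl
      rw [qPoch_succ] at this
      convert right_ne_zero_of_mul this using 1
      ring
    have huv' : ∀ j ≤ k, qPoch (q * (u * v)) (q ^ 2) j ≠ 0 := fun j hj => huv j (by omega)
    apply mul_left_cancel₀ hne
    rw [mul_comm, pairRatio_succ _ _ _ _ _ (huv _ le_rfl), sum_range_succ, mul_add,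
      sum_connCoeff_succ q u v hq0 hq hq2 k k huv' le_rfl, ← ih huv',
      ← pairRatio_succ q u v (q ^ 2) k (huv _ le_rfl)]
    have h1 := connCoeff_add q 0 k
    have h2 := connCoeff_add q 0 (k + 1)
    simp only [mul_zero, zero_add, pow_zero, Nat.choose_zero_succ, qPoch_zero, add_zero, mul_one,
      one_mul, choose_two_succ] at h1 h2
    have a1 := hq k
    have a2 := hq (k + 1)
    rw [h1, h2]
    field_simp
    ring

theorem qPoch_neg_inv (q : ℂ) (hq0 : q ≠ 0) (m l : ℕ) :
    q ^ (m + l + 1).choose 2 * qPoch (-(q ^ (m + l))⁻¹) q l * qPoch (-q) q m =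
      q ^ (m + 1).choose 2 * qPoch (-q) q (m + l) := by
  induction l generalizing m with
  | zero => simp [qPoch_zero]
  | succ l ih =>
    have h := ih (m + 1)
    rw [qPoch_succ (-q) q m, show m + 1 + l = m + (l + 1) by ring] at h
    have e : q ^ l * (q ^ (m + (l + 1)))⁻¹ * q ^ (m + 1) = 1 := by
      rw [show m + (l + 1) = l + (m + 1) by ring, pow_add q l]
      have h1 := pow_ne_zero l hq0
      have h2 := pow_ne_zero (m + 1) hq0
      field_simp
    rw [choose_two_succ (m + 1)] at h
    apply mul_left_cancel₀ (pow_ne_zero (m + 1) hq0)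
    rw [qPoch_succ _ q l]
    linear_combination h + q ^ (m + (l + 1) + 1).choose 2 *
      qPoch (-(q ^ (m + (l + 1)))⁻¹) q l * qPoch (-q) q m * e

/-- Summing the coefficients of the base `q` series against the connection coefficients. -/
theorem sum_mul_connCoeff (q c : ℂ) (hq0 : q ≠ 0) (hq : ∀ k, qPoch q q k ≠ 0)
    (hq2 : ∀ k, qPoch (q ^ 2) (q ^ 2) k ≠ 0) (n j : ℕ) (hc : qPoch c q (2 * j) ≠ 0) :
    ∑ k ∈ range (n + 1), qPoch (q ^ n)⁻¹ q k * qPoch (-(q ^ n * c)) q k * q ^ k /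
        (qPoch q q k * qPoch c q k) * connCoeff q k j =
      qPoch ((q ^ n)⁻¹ ^ 2) (q ^ 2) j * qPoch ((q ^ n * c) ^ 2) (q ^ 2) j * q ^ (2 * j) /
        (qPoch (q ^ 2) (q ^ 2) j * qPoch c q (2 * j)) := by
  have hzero : ∀ k, n < k → qPoch (q ^ n)⁻¹ q k = 0 := fun k hk =>
    prod_eq_zero (mem_range.2 hk) (by rw [inv_mul_cancel₀ (pow_ne_zero _ hq0), sub_self])
  have hneg : ∀ k, qPoch (-q) q k ≠ 0 := fun k => by
    have := hq2 k
    rw [qPoch_sq] at this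
    exact right_ne_zero_of_mul this
  set f : ℕ → ℂ := fun k => qPoch (q ^ n)⁻¹ q k * qPoch (-(q ^ n * c)) q k * q ^ k /
        (qPoch q q k * qPoch c q k) * connCoeff q k j with hf
  have hrange : ∑ k ∈ range (n + 1), f k = ∑ m ∈ range (j + 1), f (j + m) := by
    have e1 : ∑ k ∈ range (n + 1), f k = ∑ k ∈ range (n + 2 * j + 1), f k := by
      refine sum_subset (range_subset_range.2 (by omega)) fun k _ hk => ?_
      simp only [hf, hzero k (by simpa using hk), zero_mul, zero_div]
    have e2 : ∑ k ∈ Ico j (2 * j + 1), f k = ∑ k ∈ range (n + 2 * j + 1), f k := by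
      refine sum_subset (fun k hk => ?_) fun k _ hk => ?_
      · simp only [mem_Ico, mem_range] at *
        omega
      · simp only [hf]
        rw [connCoeff_eq_zero, mul_zero]
        simp only [mem_Ico] at hk
        omega
    rw [e1, ← e2, sum_Ico_eq_sum_range, show 2 * j + 1 - j = j + 1 by omega]
  have hterm : ∀ m ∈ range (j + 1), f (j + m) =
      qPoch (q ^ n)⁻¹ q j * qPoch (-(q ^ n * c)) q j * q ^ (2 * j) /
        (qPoch (q ^ 2) (q ^ 2) j * qPoch c q (2 * j)) *
        saalTerm q ((q ^ n)⁻¹ * q ^ j) (-(q ^ n * c) * q ^ j) (-(q ^ j)⁻¹) j m := by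
    intro m hm
    obtain ⟨l, rfl⟩ := Nat.exists_eq_add_of_le (mem_range_succ_iff.1 hm)
    simp only [hf, saalTerm, show m + l - m = l by omega]
    have h1 := connCoeff_add q m l
    have hw := qPoch_neg_inv q hq0 m l
    have hc' := hc
    rw [show 2 * (m + l) = m + l + m + l by ring, qPoch_add c q (m + l + m)] at hc'
    have c1 := left_ne_zero_of_mul hc'
    have c2 := right_ne_zero_of_mul hc'
    have e : -(q ^ (m + l))⁻¹ * ((q ^ n)⁻¹ * q ^ (m + l)) * (-(q ^ n * c) * q ^ (m + l)) * q ^ m =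
        c * q ^ (m + l + m) := by
      have := pow_ne_zero n hq0
      field_simp
      ring
    rw [e]
    rw [show 2 * m + l = m + l + m by ring] at h1
    rw [h1, show 2 * (m + l) = m + l + m + l by ring, qPoch_add c q (m + l + m),
      qPoch_add (q ^ n)⁻¹, qPoch_add (-(q ^ n * c)), qPoch_sq q q m, qPoch_sq q q (m + l)]
    have a1 := hq m
    have a2 := hq l
    have a3 := hq (m + l)
    have a4 := hneg m
    have a5 := hneg (m + l)
    have a6 := hq (m + l + m)
    generalize qPoch (-(q ^ n * c)) q (m + l) = X1 at *
    generalize qPoch (-(q ^ n * c) * q ^ (m + l)) q m = X2 at *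
    generalize qPoch ((q ^ n)⁻¹) q (m + l) = X3 at *
    generalize qPoch ((q ^ n)⁻¹ * q ^ (m + l)) q m = X4 at *
    generalize qPoch (c * q ^ (m + l + m)) q l = X5 at *
    have hw' : qPoch (-(q ^ (m + l))⁻¹) q l = q ^ (m + 1).choose 2 * qPoch (-q) q (m + l) /
        (q ^ (m + l + 1).choose 2 * qPoch (-q) q m) := by
      rw [eq_div_iff (mul_ne_zero (pow_ne_zero _ hq0) a4), ← hw]
      ring
    have hs : (-(q ^ (m + l))⁻¹) ^ m = (-1) ^ m / q ^ ((m + l) * m) := by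
      rw [neg_pow, inv_pow, ← pow_mul]
      rfl
    rw [hw', hs]
    simp only [choose_two_succ]
    field_simp
    ring
  rw [hrange, sum_congr rfl hterm, ← mul_sum, sum_saalTerm _ _ _ _ hq, qPoch_sq (q ^ n)⁻¹,
    qPoch_sq (q ^ n * c)]
  have hj := pow_ne_zero j hq0
  rw [show -(q ^ j)⁻¹ * ((q ^ n)⁻¹ * q ^ j) = -(q ^ n)⁻¹ by field_simp,
    show -(q ^ j)⁻¹ * (-(q ^ n * c) * q ^ j) = q ^ n * c by field_simp]
  ring

theorem qc_natCast (q : ℝ) (hq : q ≠ 0) (n : ℕ) : qc q n = (q : ℂ) ^ n := by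
  rw [qc, Complex.exp_nat_mul, Complex.exp_log (by exact_mod_cast hq)]

theorem qc_neg (q : ℝ) (x : ℂ) : qc q (-x) = (qc q x)⁻¹ := by
  rw [qc, qc, neg_mul, Complex.exp_neg]

theorem qPoch_self_ne_zero {q : ℝ} (hq0 : 0 < q) (hq1 : q < 1) (k : ℕ) :
    qPoch (q : ℂ) q k ≠ 0 := by
  refine prod_ne_zero_iff.2 fun i _ => ?_
  rw [← pow_succ', sub_ne_zero]
  exact_mod_cast (pow_lt_one₀ hq0.le hq1 i.succ_ne_zero).ne'

end

/-- Singh's quadratic transformation formula for terminating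
balanced `₄φ₃` series (with `Real.sqrt q = q^{1/2}` the positive square root). -/
theorem stmt17 (q : ℝ) (hq0 : 0 < q) (hq1 : q < 1) (n : ℕ) (a b : ℂ)
    (ha : a ≠ 0) (hb : b ≠ 0) (x : ℂ)
    (h1 : ∀ j ≤ n, qPoch (a * b) ((q : ℂ) ^ 2) j ≠ 0)
    (h2 : ∀ j ≤ n, qPoch ((q : ℂ) * a ^ 2) ((q : ℂ) ^ 2) j ≠ 0)
    (h3 : ∀ j ≤ n, qPoch ((q : ℂ) * a * b) ((q : ℂ) ^ 2) j ≠ 0)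
    (h4 : ∀ j ≤ n, qPoch (a * b) (q : ℂ) j ≠ 0)
    (h5 : ∀ j ≤ n, qPoch ((Real.sqrt q : ℂ) * a) (q : ℂ) j ≠ 0)
    (h6 : ∀ j ≤ n, qPoch (-((Real.sqrt q : ℂ) * a)) (q : ℂ) j ≠ 0) :
    (∑ j ∈ Finset.range (n + 1),
      (qPoch (qc q (-(2 * (n : ℂ)))) ((q : ℂ) ^ 2) j * qPoch (a * qc q x) ((q : ℂ) ^ 2) j *
        qPoch (a * qc q (-x)) ((q : ℂ) ^ 2) j *
        qPoch (qc q (2 * (n : ℂ)) * a ^ 2 * b ^ 2) ((q : ℂ) ^ 2) j) * (q : ℂ) ^ (2 * j) /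
      (qPoch ((q : ℂ) ^ 2) ((q : ℂ) ^ 2) j * qPoch (a * b) ((q : ℂ) ^ 2) j *
        qPoch ((q : ℂ) * a ^ 2) ((q : ℂ) ^ 2) j *
        qPoch ((q : ℂ) * a * b) ((q : ℂ) ^ 2) j)) =
    (∑ j ∈ Finset.range (n + 1),
      (qPoch (qc q (-(n : ℂ))) (q : ℂ) j * qPoch (a * qc q x) (q : ℂ) j *
        qPoch (a * qc q (-x)) (q : ℂ) j *
        qPoch (-(qc q (n : ℂ) * a * b)) (q : ℂ) j) * (q : ℂ) ^ j /
      (qPoch (q : ℂ) (q : ℂ) j * qPoch (a * b) (q : ℂ) j *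
        qPoch ((Real.sqrt q : ℂ) * a) (q : ℂ) j *
        qPoch (-((Real.sqrt q : ℂ) * a)) (q : ℂ) j)) := by
  have hq0' : (q : ℂ) ≠ 0 := by exact_mod_cast hq0.ne'
  have hq : ∀ k, qPoch (q : ℂ) q k ≠ 0 := qPoch_self_ne_zero hq0 hq1
  have hq2 : ∀ k, qPoch ((q : ℂ) ^ 2) ((q : ℂ) ^ 2) k ≠ 0 := by
    intro k
    have := qPoch_self_ne_zero (pow_pos hq0 2) (pow_lt_one₀ hq0.le hq1 two_ne_zero) k
    push_cast at this
    exact this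
  have hsqrt : ((Real.sqrt q : ℝ) : ℂ) ^ 2 = q := by
    exact_mod_cast Real.sq_sqrt hq0.le
  have huv : a * qc q x * (a * qc q (-x)) = a ^ 2 := by
    have : qc q x ≠ 0 := Complex.exp_ne_zero _
    rw [qc_neg]
    field_simp
  have hsq : ∀ k, qPoch ((Real.sqrt q : ℂ) * a) (q : ℂ) k *
      qPoch (-((Real.sqrt q : ℂ) * a)) (q : ℂ) k = qPoch ((q : ℂ) * a ^ 2) ((q : ℂ) ^ 2) k := by
    intro k
    rw [← qPoch_sq, mul_pow, hsqrt]
  have hexpand : ∀ k ≤ n, pairRatio q (a * qc q x) (a * qc q (-x)) q k =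
      ∑ j ∈ Finset.range (n + 1),
        connCoeff q k j * pairRatio q (a * qc q x) (a * qc q (-x)) ((q : ℂ) ^ 2) j := by
    intro k hk
    rw [pairRatio_eq_sum _ _ _ hq0' hq hq2 k fun j hj => by rw [huv]; exact h2 j (hj.trans hk)]
    refine Finset.sum_subset (Finset.range_subset_range.2 (by omega)) fun j _ hj => ?_
    rw [connCoeff_eq_zero (Or.inl (by simpa using hj)), zero_mul]
  have e1 : qc q (2 * (n : ℂ)) = (q : ℂ) ^ (2 * n) := by
    rw [← qc_natCast q hq0.ne']
    push_cast
    rfl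
  rw [qc_neg q (2 * n), qc_neg q n, e1, qc_natCast q hq0.ne']
  trans ∑ k ∈ Finset.range (n + 1),
    qPoch ((q : ℂ) ^ n)⁻¹ q k * qPoch (-((q : ℂ) ^ n * (a * b))) q k * (q : ℂ) ^ k /
      (qPoch (q : ℂ) q k * qPoch (a * b) q k) * pairRatio q (a * qc q x) (a * qc q (-x)) q k
  · symm
    rw [Finset.sum_congr rfl fun k hk => by
      rw [hexpand k (Finset.mem_range_succ_iff.1 hk), Finset.mul_sum], Finset.sum_comm]
    refine Finset.sum_congr rfl fun j hj => ?_
    have hjn := Finset.mem_range_succ_iff.1 hj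
    have hc : qPoch (a * b) q (2 * j) ≠ 0 := by
      rw [qPoch_two_mul, ← mul_assoc]
      exact mul_ne_zero (h1 j hjn) (h3 j hjn)
    simp only [← mul_assoc (_ / _) (connCoeff _ _ _)]
    rw [← Finset.sum_mul, sum_mul_connCoeff q (a * b) hq0' hq hq2 n j hc, pairRatio, huv,
      div_mul_div_comm, qPoch_two_mul,
      show (((q : ℂ) ^ n)⁻¹) ^ 2 = ((q : ℂ) ^ (2 * n))⁻¹ by rw [inv_pow, ← pow_mul, mul_comm n],
      show ((q : ℂ) ^ n * (a * b)) ^ 2 = (q : ℂ) ^ (2 * n) * a ^ 2 * b ^ 2 by ring,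
      show (q : ℂ) * (a * b) = q * a * b by ring]
    congr 1 <;> ring
  · refine Finset.sum_congr rfl fun k _ => ?_
    rw [pairRatio, huv, ← hsq, div_mul_div_comm,
      show (q : ℂ) ^ n * (a * b) = q ^ n * a * b by ring]
    congr 1 <;> ring

end
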